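/- arXiv:1511.02789 — 2 statements merged into one kernel-verified Lean document; each statement's English description precedes it below -/
import Mathlib

section
/- Let A(Γ₀) be a dihedral Artin-Tits group with m < ∞. Then Ω(Γ₀) is closed under operations of type 2⋆; moreover, if w and w' both belong to Ω(Γ₀), then w →_{2⋆} w' if and only if w' →_{2⋆} w. -/
namespace ArtinTits

open Classical List

variable {S : Type*}

/-- A word over `S ∪ S⁻¹`: a list of letters, each a generator together with a sign
(`true` = the generator itself, `false` = its formal inverse). -/
abbrev Word (S : Type*) := List (S × Bool)

/-- The formal inverse of a word. -/
def wordInv (w : Word S) : Word S := w.reverse.map fun l => (l.1, !l.2)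

/-- `[x,y,j⟩`: the alternating positive word `xyxy⋯` with `j` letters, beginning with `x`. -/
def altWord (x y : S) : ℕ → Word S
  | 0 => []
  | j + 1 => (x, true) :: altWord y x j

/-- `⟨x,y,j]`: the alternating positive word `⋯xy` with `j` letters, ending with `y`. -/
def altWordR (x y : S) (j : ℕ) : Word S := (altWord y x j).reverse

/-- The data of a labelled finite complete simplicial graph `Γ₀`: a symmetric label map
with values in `{2,3,…} ∪ {∞}` on pairs of distinct vertices. -/
structure ArtinData (S : Type*) where
  m : S → S → ℕ∞
  symm : ∀ s t, m s t = m t s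
  two_le : ∀ s t : S, s ≠ t → 2 ≤ m s t

/-- `u = v` is a defining (braid) relation of the Artin–Tits presentation. -/
def IsRel (A : ArtinData S) (u v : Word S) : Prop :=
  ∃ (s t : S) (k : ℕ), s ≠ t ∧ A.m s t = (k : ℕ∞) ∧
    u = altWord s t k ∧ v = altWord t s k

/-- The relator set of the Artin–Tits presentation, inside the free group. -/
def rels (A : ArtinData S) : Set (FreeGroup S) :=
  {x | ∃ u v : Word S, IsRel A u v ∧ x = FreeGroup.mk u * (FreeGroup.mk v)⁻¹}

/-- The Artin–Tits group `A(Γ₀)` of the presentation. -/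
abbrev ArtinGroup (A : ArtinData S) := PresentedGroup (rels A)

/-- `w̄`: the element of the Artin–Tits group represented by the word `w`. -/
def wbar (A : ArtinData S) (w : Word S) : ArtinGroup A :=
  PresentedGroup.mk (rels A) (FreeGroup.mk w)

/-! ### Special transformations -/

/-- Type 0: delete a factor `s s⁻¹` or `s⁻¹ s`. -/
def Step0 (w w' : Word S) : Prop :=
  ∃ (w₁ w₂ : Word S) (s : S) (b : Bool),
    w = w₁ ++ [(s, b), (s, !b)] ++ w₂ ∧ w' = w₁ ++ w₂

/-- Type ∞: insert a factor `s s⁻¹` or `s⁻¹ s` (the inverse of type 0). -/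
def StepInfty (w w' : Word S) : Prop := Step0 w' w

/-- Type 1: replace a factor `v` by `u`, or `v⁻¹` by `u⁻¹`, where `u = v` is a defining
relation. -/
def Step1 (A : ArtinData S) (w w' : Word S) : Prop :=
  ∃ (w₁ w₂ u v : Word S), IsRel A u v ∧
    ((w = w₁ ++ v ++ w₂ ∧ w' = w₁ ++ u ++ w₂) ∨
     (w = w₁ ++ wordInv v ++ w₂ ∧ w' = w₁ ++ wordInv u ++ w₂))

/-- Type 2r: for a defining relation `u₁u₂ = v₁v₂` with `u₁, v₁` non-empty, replace a factor
`v₁⁻¹ u₁` by `v₂ u₂⁻¹`. -/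
def Step2r (A : ArtinData S) (w w' : Word S) : Prop :=
  ∃ (w₁ w₂ u₁ u₂ v₁ v₂ : Word S), IsRel A (u₁ ++ u₂) (v₁ ++ v₂) ∧
    u₁ ≠ [] ∧ v₁ ≠ [] ∧
    w = w₁ ++ wordInv v₁ ++ u₁ ++ w₂ ∧ w' = w₁ ++ v₂ ++ wordInv u₂ ++ w₂

/-- Type 2l: for a defining relation `u₁u₂ = v₁v₂` with `u₂, v₂` non-empty, replace a factor
`v₂ u₂⁻¹` by `v₁⁻¹ u₁`. -/
def Step2l (A : ArtinData S) (w w' : Word S) : Prop :=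
  ∃ (w₁ w₂ u₁ u₂ v₁ v₂ : Word S), IsRel A (u₁ ++ u₂) (v₁ ++ v₂) ∧
    u₂ ≠ [] ∧ v₂ ≠ [] ∧
    w = w₁ ++ v₂ ++ wordInv u₂ ++ w₂ ∧ w' = w₁ ++ wordInv v₁ ++ u₁ ++ w₂

/-- Type 2: a type 2r or type 2l transformation. -/
def Step2 (A : ArtinData S) (w w' : Word S) : Prop := Step2r A w w' ∨ Step2l A w w'

/-- `p` is the greatest (longest) common left factor of `x` and `y`. -/
def IsLCPrefix (p x y : Word S) : Prop :=
  p <+: x ∧ p <+: y ∧ ∀ q : Word S, q <+: x → q <+: y → q.length ≤ p.length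

/-- `p` is the greatest (longest) common right factor of `x` and `y`. -/
def IsLCSuffix (p x y : Word S) : Prop :=
  p <:+ x ∧ p <:+ y ∧ ∀ q : Word S, q <:+ x → q <:+ y → q.length ≤ p.length

/-- Type 2r⋆ : a type 2r transformation `w₁ v⁻¹ v' w₂ → w₁ u (u')⁻¹ w₂` (with `vu = v'u'` a
defining relation) such that `v` is the greatest common left factor of `vu` and `v w₁⁻¹`, and
`v'` is the greatest common left factor of `v'u'` and `v' w₂`. -/
def Step2rStar (A : ArtinData S) (w w' : Word S) : Prop :=
  ∃ (w₁ w₂ v u v' u' : Word S), IsRel A (v ++ u) (v' ++ u') ∧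
    v ≠ [] ∧ v' ≠ [] ∧
    w = w₁ ++ wordInv v ++ v' ++ w₂ ∧
    w' = w₁ ++ u ++ wordInv u' ++ w₂ ∧
    IsLCPrefix v (v ++ u) (v ++ wordInv w₁) ∧
    IsLCPrefix v' (v' ++ u') (v' ++ w₂)

/-- Type 2l⋆ : a type 2l transformation `w₁ v (v')⁻¹ w₂ → w₁ u⁻¹ u' w₂` (with `uv = u'v'` a
defining relation) such that `v` is the greatest common right factor of `uv` and `w₁ v`, and
`v'` is the greatest common right factor of `u'v'` and `w₂⁻¹ v'`. -/
def Step2lStar (A : ArtinData S) (w w' : Word S) : Prop :=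
  ∃ (w₁ w₂ v u v' u' : Word S), IsRel A (u ++ v) (u' ++ v') ∧
    v ≠ [] ∧ v' ≠ [] ∧
    w = w₁ ++ v ++ wordInv v' ++ w₂ ∧
    w' = w₁ ++ wordInv u ++ u' ++ w₂ ∧
    IsLCSuffix v (u ++ v) (w₁ ++ v) ∧
    IsLCSuffix v' (u' ++ v') (wordInv w₂ ++ v')

/-- Type 2⋆ : a type 2r⋆ or type 2l⋆ transformation. -/
def Step2Star (A : ArtinData S) (w w' : Word S) : Prop :=
  Step2rStar A w w' ∨ Step2lStar A w w'

/-- `w →_{0,1,2} w'`. -/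
def Steps012 (A : ArtinData S) : Word S → Word S → Prop :=
  Relation.ReflTransGen fun x y => Step0 x y ∨ Step1 A x y ∨ Step2 A x y

/-- `w →_{0,1,2⋆} w'`. -/
def Steps012Star (A : ArtinData S) : Word S → Word S → Prop :=
  Relation.ReflTransGen fun x y => Step0 x y ∨ Step1 A x y ∨ Step2Star A x y

/-- `w →_{2⋆} w'`. -/
def Steps2Star (A : ArtinData S) : Word S → Word S → Prop :=
  Relation.ReflTransGen (Step2Star A)

/-- `w →_{1,2⋆} w'`. -/
def Steps12Star (A : ArtinData S) : Word S → Word S → Prop :=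
  Relation.ReflTransGen fun x y => Step1 A x y ∨ Step2Star A x y

/-- `w →_{1,2} w'`. -/
def Steps12 (A : ArtinData S) : Word S → Word S → Prop :=
  Relation.ReflTransGen fun x y => Step1 A x y ∨ Step2 A x y

/-! ### Classes of words -/

/-- A positive word: written over `S`. -/
def Positive (w : Word S) : Prop := ∀ l ∈ w, l.2 = true

/-- A negative word: written over `S⁻¹`. -/
def Negative (w : Word S) : Prop := ∀ l ∈ w, l.2 = false

/-- A signed word: positive or negative. -/
def Signed (w : Word S) : Prop := Positive w ∨ Negative w

/-- An unsigned word: neither positive nor negative. -/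
def Unsigned (w : Word S) : Prop := ¬ Positive w ∧ ¬ Negative w

/-- A freely reduced word: no factor `s s⁻¹` or `s⁻¹ s`. -/
def FreelyReduced (w : Word S) : Prop :=
  ∀ (w₁ w₂ : Word S) (s : S) (b : Bool), w ≠ w₁ ++ [(s, b), (s, !b)] ++ w₂

/-- A square-free word: no factor `aa`. -/
def SquareFree (w : Word S) : Prop := ∀ a : S × Bool, ¬ [a, a] <:+: w

/-- `p̃(w)`: the length of the longest square-free positive factor of `w`. -/
noncomputable def ptilde (w : Word S) : ℕ :=
  sSup {n | ∃ v : Word S, v <:+: w ∧ Positive v ∧ SquareFree v ∧ v.length = n}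

/-- `ñ(w)`: the length of the longest negative factor of `w` whose formal inverse is
square-free. -/
noncomputable def ntilde (w : Word S) : ℕ :=
  sSup {n | ∃ v : Word S, v <:+: w ∧ Negative v ∧ SquareFree (wordInv v) ∧ v.length = n}

/-- `p(w) = min(p̃(w), m)`. -/
noncomputable def pfun (M : ℕ) (w : Word S) : ℕ := min (ptilde w) M

/-- `n(w) = min(ñ(w), m)`. -/
noncomputable def nfun (M : ℕ) (w : Word S) : ℕ := min (ntilde w) M

/-- `Ω(Γ₀)` (for a dihedral presentation with label `M`): the freely reduced words with
`max(p(w), n(w)) < M`. -/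
def Omega (M : ℕ) (w : Word S) : Prop :=
  FreelyReduced w ∧ max (pfun M w) (nfun M w) < M

/-- A signed square-free word (square-free positive, or negative with square-free inverse). -/
def SignedSF (w : Word S) : Prop :=
  (Positive w ∧ SquareFree w) ∨ (Negative w ∧ SquareFree (wordInv w))

/-- `v` is the maximal square-free signed left factor of `w`. -/
def MaxSignedSFPrefix (v w : Word S) : Prop :=
  v <+: w ∧ SignedSF v ∧ ∀ v' : Word S, v' <+: w → SignedSF v' → v'.length ≤ v.length

/-- `(v₁, …, v_k)` is the `⋆`-decomposition of `w`: the `v_i` are non-empty, `w = v₁⋯v_k`,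
and each `v_i` is the maximal square-free signed left factor of `v_i⋯v_k`. -/
def StarDecomp (w : Word S) (L : List (Word S)) : Prop :=
  w = L.flatten ∧ (∀ v ∈ L, v ≠ ([] : Word S)) ∧
    ∀ i (h : i < L.length), MaxSignedSFPrefix (L.get ⟨i, h⟩) ((L.drop i).flatten)

/-! ### Groups, parabolic subgroups, geodesics -/

/-- A word written over `T ∪ T⁻¹` for a subset `T` of the generators. -/
def WordOver (T : Set S) (w : Word S) : Prop := ∀ l ∈ w, l.1 ∈ T

/-- The standard parabolic subgroup `A_T` generated by the image of `T ⊆ S`. -/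
def parab (A : ArtinData S) (T : Set S) : Subgroup (ArtinGroup A) :=
  Subgroup.closure {x | ∃ s ∈ T, x = wbar A [(s, true)]}

/-- A geodesic word: of minimal length among all words representing the same element. -/
def Geodesic (A : ArtinData S) (w : Word S) : Prop :=
  ∀ w' : Word S, wbar A w' = wbar A w → w.length ≤ w'.length

/-- A word over `T ∪ T⁻¹` that is geodesic among the words over `T ∪ T⁻¹` representing the
same element. -/
def GeodesicOver (A : ArtinData S) (T : Set S) (w : Word S) : Prop :=
  WordOver T w ∧
    ∀ w' : Word S, WordOver T w' → wbar A w' = wbar A w → w.length ≤ w'.length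

/-- The length of a group element: the length of any geodesic representative word. -/
noncomputable def elLength (A : ArtinData S) (g : ArtinGroup A) : ℕ :=
  sInf {n | ∃ w : Word S, wbar A w = g ∧ w.length = n}

/-- A positive element: one represented by a positive word. -/
def IsPosElt (A : ArtinData S) (g : ArtinGroup A) : Prop :=
  ∃ w : Word S, Positive w ∧ wbar A w = g

/-- An `H`-transversal: a subset containing `1` and exactly one element of each left
`H`-coset. -/
def IsLeftTransversal {G : Type*} [Group G] (H : Subgroup G) (T : Set G) : Prop :=
  (1 : G) ∈ T ∧ ∀ g : G, ∃! x, x ∈ T ∧ g⁻¹ * x ∈ H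

/-! ### Properties H, H⁺, H# -/

/-- Property `H`: `w →_{0,1,2} ε ↔ w̄ = 1`. -/
def PropertyH (A : ArtinData S) : Prop :=
  ∀ w : Word S, Steps012 A w [] ↔ wbar A w = 1

/-- Property `H⁺`: every word representing an element of a standard parabolic subgroup
`A_{S₀}` can be transformed by `→_{0,1,2⋆}` into a word over `S₀ ∪ S₀⁻¹`. -/
def PropertyHPlus (A : ArtinData S) : Prop :=
  ∀ (S₀ : Set S) (w : Word S), wbar A w ∈ parab A S₀ →
    ∃ w₀ : Word S, WordOver S₀ w₀ ∧ Steps012Star A w w₀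

/-- Property `H#` with respect to an `S`-sequence of transversals `T`. -/
def PropertyHSharpWrt (A : ArtinData S) (T : Set S → Set (ArtinGroup A)) : Prop :=
  (∀ S₀ : Set S, IsLeftTransversal (parab A S₀) (T S₀)) ∧
    ∀ (S' S₀ : Set S) (w : Word S), wbar A w ∈ parab A S' →
      ∃ v u : Word S, WordOver S' v ∧ WordOver (S' ∩ S₀) u ∧
        Steps012 A w (v ++ u) ∧ wbar A v ∈ T S₀

/-- Property `H#`: property `H#` with respect to some `S`-sequence of transversals. -/
def PropertyHSharp (A : ArtinData S) : Prop :=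
  ∃ T : Set S → Set (ArtinGroup A), PropertyHSharpWrt A T

/-! ### Critical words and the involution τ (relative to a dihedral pair) -/

/-- The permutation `δ` induced by conjugation by `Δ`, extended letterwise to words:
the identity if `M` is even, and the swap of `s` and `t` if `M` is odd. -/
noncomputable def deltaMap (s t : S) (M : ℕ) (w : Word S) : Word S :=
  if Even M then w
  else w.map fun l => (if l.1 = s then t else if l.1 = t then s else l.1, l.2)

/-- `w` is an unsigned critical word (of the dihedral pair `{s,t}` with label `M`) and
`w' = τ(w)`. -/
def UCritTauPair (A : ArtinData S) (s t : S) (M : ℕ) (w w' : Word S) : Prop :=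
  WordOver {s, t} w ∧ FreelyReduced w ∧ Unsigned w ∧ GeodesicOver A {s, t} w ∧
  pfun M w + nfun M w = M ∧
  ∃ (x y z z' : S) (wm : Word S),
    ({x, y} : Set S) = {s, t} ∧ ({z, z'} : Set S) = {s, t} ∧
    ((w = altWord x y (pfun M w) ++ wm ++ wordInv (altWord z z' (nfun M w)) ∧
      w' = wordInv (altWordR x y (nfun M w)) ++ deltaMap s t M wm ++
        altWordR z z' (pfun M w)) ∨
     (w = wordInv (altWordR x y (nfun M w)) ++ wm ++ altWordR z z' (pfun M w) ∧
      w' = altWord x y (pfun M w) ++ deltaMap s t M wm ++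
        wordInv (altWord z z' (nfun M w))))

/-- `w` is a positive critical word (of the dihedral pair `{s,t}` with label `M`) and
`w' = τ(w)`. -/
def PosCritTauPair (A : ArtinData S) (s t : S) (M : ℕ) (w w' : Word S) : Prop :=
  WordOver {s, t} w ∧ Positive w ∧ pfun M w = M ∧
  ∃ (x y : S) (wm : Word S), ({x, y} : Set S) = {s, t} ∧ pfun M wm < M ∧
    ((w = altWord x y M ++ wm ∧
      (w' = deltaMap s t M wm ++ altWordR x y M ∨
       w' = deltaMap s t M wm ++ altWordR y x M) ∧
      w'.getLast? ≠ w.getLast?) ∨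
     (w = wm ++ altWordR x y M ∧
      (w' = altWord x y M ++ deltaMap s t M wm ∨
       w' = altWord y x M ++ deltaMap s t M wm) ∧
      w'.head? ≠ w.head?))

/-- `w` is a negative critical word and `w' = τ(w)` (defined via formal inverses). -/
def NegCritTauPair (A : ArtinData S) (s t : S) (M : ℕ) (w w' : Word S) : Prop :=
  PosCritTauPair A s t M (wordInv w) (wordInv w')

/-- `w` is a critical word (unsigned, positive or negative) and `w' = τ(w)`. -/
def CritTauPair (A : ArtinData S) (s t : S) (M : ℕ) (w w' : Word S) : Prop :=
  UCritTauPair A s t M w w' ∨ PosCritTauPair A s t M w w' ∨ NegCritTauPair A s t M w w'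

/-- A type β transformation relative to the dihedral pair `{s,t}` with label `M`:
replace a critical factor `v` by `τ(v)`. -/
def StepBetaPair (A : ArtinData S) (s t : S) (M : ℕ) (w w' : Word S) : Prop :=
  ∃ (w₁ w₂ v v' : Word S), w = w₁ ++ v ++ w₂ ∧ w' = w₁ ++ v' ++ w₂ ∧
    CritTauPair A s t M v v'

/-- A type β transformation (in an Artin–Tits group): a type β transformation relative to some
dihedral standard parabolic subgroup (a pair of generators with finite label). -/
def StepBeta (A : ArtinData S) (w w' : Word S) : Prop :=
  ∃ (s t : S) (M : ℕ), s ≠ t ∧ A.m s t = (M : ℕ∞) ∧ StepBetaPair A s t M w w'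

/-! ### Restriction, direct products, Coxeter graph notions -/

/-- The Artin–Tits presentation induced on a subset `T` of the generators (the presentation of
the standard parabolic subgroup `A_T`). -/
def ArtinData.restrict (A : ArtinData S) (T : Set S) : ArtinData T where
  m a b := A.m a b
  symm a b := A.symm a b
  two_le a b h := A.two_le a b fun h' => h (Subtype.ext h')

/-- The Artin–Tits presentation on the disjoint union `S₁ ⊕ S₂` obtained from presentations on
`S₁` and `S₂` by adding the commuting relations `s₁s₂ = s₂s₁` (label `2`) for `s₁ ∈ S₁`,
`s₂ ∈ S₂`. -/
def prodData {S₁ S₂ : Type*} (A₁ : ArtinData S₁) (A₂ : ArtinData S₂) :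
    ArtinData (S₁ ⊕ S₂) where
  m x y :=
    match x, y with
    | Sum.inl a, Sum.inl b => A₁.m a b
    | Sum.inr a, Sum.inr b => A₂.m a b
    | _, _ => 2
  symm x y := by
    cases x <;> cases y
    · exact A₁.symm _ _
    · rfl
    · rfl
    · exact A₂.symm _ _
  two_le x y h := by
    cases x <;> cases y
    · exact A₁.two_le _ _ fun h' => h (congrArg Sum.inl h')
    · exact le_rfl
    · exact le_rfl
    · exact A₂.two_le _ _ fun h' => h (congrArg Sum.inr h')

/-- Adjacency in the Coxeter graph `Γ` restricted to `T`: distinct vertices of `T` joined by an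
edge (i.e. with label `≠ 2`, edges labelled `2` being removed in `Γ`). -/
def coxAdj (A : ArtinData S) (T : Set S) (x y : S) : Prop :=
  x ∈ T ∧ y ∈ T ∧ x ≠ y ∧ A.m x y ≠ 2

/-- The full subgraph of the Coxeter graph on the vertex subset `T` is connected. -/
def CoxConnected (A : ArtinData S) (T : Set S) : Prop :=
  ∀ x ∈ T, ∀ y ∈ T, Relation.ReflTransGen (coxAdj A T) x y

/-- The relator set of the Coxeter presentation on `T`: the Artin relations together with the
squares of the generators. -/
def coxRels (A : ArtinData S) (T : Set S) : Set (FreeGroup T) :=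
  rels (A.restrict T) ∪ {g | ∃ x : T, g = FreeGroup.of x * FreeGroup.of x}

/-- The induced presentation on `T` is of spherical type: its Coxeter group is finite. -/
def SphericalType (A : ArtinData S) (T : Set S) : Prop :=
  Finite (PresentedGroup (coxRels A T))

/-- The induced presentation on `T` is of large type: all labels are `≥ 3` (possibly `∞`). -/
def LargeTypeOn (A : ArtinData S) (T : Set S) : Prop :=
  ∀ x ∈ T, ∀ y ∈ T, x ≠ y → 3 ≤ A.m x y

/-! ### Adjacency relations describing `Ω` -/

/-- Two letters that are not formal inverses of each other. -/
def NoCancel (a b : S × Bool) : Prop := ¬ (a.1 = b.1 ∧ a.2 ≠ b.2)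

/-- Two letters with the same sign and distinct generators. -/
def Alternating (a b : S × Bool) : Prop := a.2 = b.2 ∧ a.1 ≠ b.1

/-- All factors of `w` with successive letters alternating have length less than `M`. -/
def RunsLt (M : ℕ) (w : Word S) : Prop :=
  ∀ v : Word S, v <:+: w → v.IsChain Alternating → v.length < M

theorem NoCancel.symm {a b : S × Bool} (h : NoCancel a b) : NoCancel b a :=
  fun h' => h ⟨h'.1.symm, h'.2.symm⟩

theorem Alternating.symm {a b : S × Bool} (h : Alternating a b) : Alternating b a :=
  ⟨h.1.symm, h.2.symm⟩

theorem Alternating.noCancel {a b : S × Bool} (h : Alternating a b) : NoCancel a b :=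
  fun h' => h.2 h'.1

theorem noCancel_comm {a b : S × Bool} : NoCancel a b ↔ NoCancel b a :=
  ⟨NoCancel.symm, NoCancel.symm⟩

theorem alternating_comm {a b : S × Bool} : Alternating a b ↔ Alternating b a :=
  ⟨Alternating.symm, Alternating.symm⟩

theorem isChain_noCancel_reverse {w : Word S} :
    w.reverse.IsChain NoCancel ↔ w.IsChain NoCancel :=
  List.isChain_reverse.trans (List.IsChain.iff fun _ _ => noCancel_comm)

theorem isChain_alternating_reverse {w : Word S} :
    w.reverse.IsChain Alternating ↔ w.IsChain Alternating :=
  List.isChain_reverse.trans (List.IsChain.iff fun _ _ => alternating_comm)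

theorem isChain_alternating_wordInv {w : Word S} :
    (wordInv w).IsChain Alternating ↔ w.IsChain Alternating := by
  rw [wordInv, List.isChain_map, ← isChain_alternating_reverse (w := w)]
  exact List.IsChain.iff fun a b => by simp [Alternating]

theorem freelyReduced_iff_isChain {w : Word S} : FreelyReduced w ↔ w.IsChain NoCancel := by
  rw [List.isChain_iff_forall_rel_of_append_cons_cons]
  constructor
  · rintro h ⟨a, x⟩ ⟨b, y⟩ l₁ l₂ rfl ⟨h₁, h₂⟩
    refine h l₁ l₂ a x ?_
    have : y = !x := by cases x <;> cases y <;> simp_all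
    simp_all
  · rintro h w₁ w₂ a x rfl
    exact h (a := (a, x)) (b := (a, !x)) (l₁ := w₁) (l₂ := w₂) (by simp) ⟨rfl, by simp⟩

theorem squareFree_iff_isChain {w : Word S} : SquareFree w ↔ w.IsChain (· ≠ ·) := by
  rw [List.isChain_iff_forall_rel_of_append_cons_cons]
  constructor
  · rintro h a b l₁ l₂ rfl rfl
    exact h a ⟨l₁, l₂, by simp⟩
  · rintro h a ⟨l₁, l₂, rfl⟩
    exact h (a := a) (b := a) (l₁ := l₁) (l₂ := l₂) (by simp) rfl

theorem squareFree_wordInv {w : Word S} : SquareFree (wordInv w) ↔ SquareFree w := by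
  rw [squareFree_iff_isChain, squareFree_iff_isChain, wordInv, List.isChain_map,
    List.isChain_reverse]
  refine List.IsChain.iff fun a b => ?_
  rw [not_iff_not]
  simp [Prod.ext_iff, eq_comm]

theorem isChain_alternating_of_sign {w : Word S} {b : Bool} (h : ∀ l ∈ w, l.2 = b) :
    w.IsChain Alternating ↔ SquareFree w := by
  rw [squareFree_iff_isChain]
  refine List.IsChain.iff_of_mem_imp fun x y hx hy => ?_
  simp [Alternating, Prod.ext_iff, h x hx, h y hy]

theorem sign_eq_of_isChain_alternating {a : S × Bool} {w : Word S}
    (h : (a :: w).IsChain Alternating) : ∀ l ∈ w, l.2 = a.2 := by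
  induction w generalizing a with
  | nil => simp
  | cons b w ih =>
    rw [List.isChain_cons_cons] at h
    intro l hl
    rcases List.mem_cons.1 hl with rfl | hl
    · exact h.1.1.symm
    · exact (ih h.2 l hl).trans h.1.1.symm

theorem signedSF_iff_isChain {w : Word S} : SignedSF w ↔ w.IsChain Alternating := by
  rw [SignedSF, squareFree_wordInv]
  constructor
  · rintro (⟨h, h'⟩ | ⟨h, h'⟩) <;> exact (isChain_alternating_of_sign h).2 h'
  · intro h
    have hsq : ∀ b : Bool, (∀ l ∈ w, l.2 = b) → SquareFree w :=
      fun b hb => (isChain_alternating_of_sign hb).1 h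
    cases w with
    | nil => exact Or.inl ⟨by simp [Positive], hsq true (by simp)⟩
    | cons a w =>
      have hs : ∀ l ∈ a :: w, l.2 = a.2 := by
        simpa using sign_eq_of_isChain_alternating h
      cases ha : a.2 with
      | true => exact Or.inl ⟨fun l hl => (hs l hl).trans ha, hsq _ hs⟩
      | false => exact Or.inr ⟨fun l hl => (hs l hl).trans ha, hsq _ hs⟩

theorem sSup_factor_length_lt_iff {P : Word S → Prop} (hP : P []) {M : ℕ} {w : Word S} :
    sSup {n | ∃ v : Word S, v <:+: w ∧ P v ∧ v.length = n} < M ↔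
      ∀ v : Word S, v <:+: w → P v → v.length < M := by
  have hne : {n | ∃ v : Word S, v <:+: w ∧ P v ∧ v.length = n}.Nonempty :=
    ⟨0, [], List.nil_infix, hP, rfl⟩
  have hbdd : BddAbove {n | ∃ v : Word S, v <:+: w ∧ P v ∧ v.length = n} :=
    ⟨w.length, by rintro _ ⟨v, hv, -, rfl⟩; exact hv.length_le⟩
  constructor
  · exact fun h v hv hp => (le_csSup hbdd ⟨v, hv, hp, rfl⟩).trans_lt h
  · intro h
    obtain ⟨v, hv, hp, hn⟩ := Nat.sSup_mem hne hbdd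
    rw [← hn]
    exact h v hv hp

theorem omega_iff {M : ℕ} {w : Word S} : Omega M w ↔ w.IsChain NoCancel ∧ RunsLt M w := by
  rw [Omega, freelyReduced_iff_isChain]
  refine and_congr_right fun _ => ?_
  have hp : ptilde w < M ↔ ∀ v : Word S, v <:+: w → (Positive v ∧ SquareFree v) →
      v.length < M := by
    rw [← sSup_factor_length_lt_iff (P := fun v => Positive v ∧ SquareFree v)
      ⟨by simp [Positive], by simp [SquareFree]⟩]
    simp [ptilde, and_assoc]
  have hn : ntilde w < M ↔ ∀ v : Word S, v <:+: w → (Negative v ∧ SquareFree (wordInv v)) →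
      v.length < M := by
    rw [← sSup_factor_length_lt_iff (P := fun v => Negative v ∧ SquareFree (wordInv v))
      ⟨by simp [Negative], by simp [SquareFree, wordInv]⟩]
    simp [ntilde, and_assoc]
  have hmax : max (pfun M w) (nfun M w) < M ↔ ptilde w < M ∧ ntilde w < M := by
    unfold pfun nfun
    omega
  rw [hmax, hp, hn]
  constructor
  · intro h v hv hc
    rcases signedSF_iff_isChain.2 hc with h' | h'
    · exact h.1 v hv h'
    · exact h.2 v hv h'
  · exact fun h => ⟨fun v hv h' => h v hv (signedSF_iff_isChain.1 (Or.inl h')),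
      fun v hv h' => h v hv (signedSF_iff_isChain.1 (Or.inr h'))⟩

theorem RunsLt.factor {M : ℕ} {v w : Word S} (h : RunsLt M w) (hv : v <:+: w) : RunsLt M v :=
  fun x hx => h x (hx.trans hv)

theorem RunsLt.append {M : ℕ} {p q : Word S} (hp : RunsLt M p) (hq : RunsLt M q)
    (hpq : ∀ a ∈ p.getLast?, ∀ b ∈ q.head?, ¬ Alternating a b) : RunsLt M (p ++ q) := by
  intro v hv hc
  rcases List.infix_append_iff_ne_nil.1 hv with h | h | ⟨x, y, hx, hy, rfl, ⟨p', rfl⟩, ⟨q', rfl⟩⟩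
  · exact hp v h hc
  · exact hq v h hc
  · obtain ⟨x, a, rfl⟩ := List.eq_nil_or_concat' x |>.resolve_left hx
    obtain ⟨b, y, rfl⟩ := List.exists_cons_of_ne_nil hy
    refine absurd ((List.isChain_append.1 hc).2.2 a (by simp) b (by simp))
      (hpq a ?_ b (by simp))
    rw [← List.append_assoc]
    simp

theorem Omega.reverse {M : ℕ} {w : Word S} (h : Omega M w) : Omega M w.reverse := by
  rw [omega_iff] at h ⊢
  refine ⟨isChain_noCancel_reverse.2 h.1, fun v hv hc => ?_⟩
  rw [← List.length_reverse]
  exact h.2 _ (by simpa using List.reverse_infix.2 hv) (isChain_alternating_reverse.2 hc)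

/-! ### Alternating words and defining relations -/

theorem length_altWord (x y : S) (k : ℕ) : (altWord x y k).length = k := by
  induction k generalizing x y with
  | zero => rfl
  | succ k ih => simp [altWord, ih]

theorem positive_altWord (x y : S) (k : ℕ) : Positive (altWord x y k) := by
  induction k generalizing x y with
  | zero => simp [altWord, Positive]
  | succ k ih => simpa [altWord, Positive] using ih y x

theorem altWord_succ' (x y : S) (k : ℕ) :
    altWord x y (k + 1) = altWord x y k ++ [(if Even k then x else y, true)] := by
  induction k generalizing x y with
  | zero => simp [altWord]
  | succ k ih =>
    rw [altWord, ih, altWord]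
    by_cases hk : Even k <;> simp [hk, Nat.even_add_one]

theorem reverse_altWord (x y : S) (k : ℕ) :
    (altWord x y k).reverse = if Even k then altWord y x k else altWord x y k := by
  induction k generalizing x y with
  | zero => simp [altWord]
  | succ k ih =>
    rw [altWord_succ', List.reverse_append, ih]
    have h := altWord_succ' x y k
    by_cases hk : Even k <;> simp_all [Nat.even_add_one, altWord]

theorem isChain_altWord {x y : S} (h : x ≠ y) (k : ℕ) :
    (altWord x y k).IsChain Alternating := by
  induction k generalizing x y with
  | zero => simp [altWord]
  | succ k ih =>
    rw [altWord, List.isChain_cons]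
    refine ⟨?_, ih h.symm⟩
    cases k with
    | zero => simp [altWord]
    | succ k => simp [altWord, Alternating, h]

variable {A : ArtinData S} {u v : Word S}

theorem IsRel.symm (h : IsRel A u v) : IsRel A v u := by
  obtain ⟨s, t, k, hst, hk, rfl, rfl⟩ := h
  exact ⟨t, s, k, hst.symm, by rw [A.symm, hk], rfl, rfl⟩

theorem IsRel.reverse (h : IsRel A u v) : IsRel A u.reverse v.reverse := by
  obtain ⟨s, t, k, hst, hk, rfl, rfl⟩ := h
  rw [reverse_altWord, reverse_altWord]
  split_ifs
  · exact ⟨t, s, k, hst.symm, by rw [A.symm, hk], rfl, rfl⟩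
  · exact ⟨s, t, k, hst, hk, rfl, rfl⟩

theorem IsRel.isChain (h : IsRel A u v) : u.IsChain Alternating := by
  obtain ⟨s, t, k, hst, -, rfl, -⟩ := h
  exact isChain_altWord hst k

theorem IsRel.positive (h : IsRel A u v) : Positive u := by
  obtain ⟨s, t, k, -, -, rfl, -⟩ := h
  exact positive_altWord s t k

theorem IsRel.head_ne (h : IsRel A u v) : ∀ a ∈ u.head?, ∀ b ∈ v.head?, a.1 ≠ b.1 := by
  obtain ⟨s, t, k, hst, -, rfl, rfl⟩ := h
  cases k <;> simp [altWord, hst]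

theorem IsRel.getLast_ne (h : IsRel A u v) :
    ∀ a ∈ u.getLast?, ∀ b ∈ v.getLast?, a.1 ≠ b.1 := by
  simpa using h.reverse.head_ne

theorem IsRel.length_eq {s t : S} {M : ℕ} (hdih : ∀ x : S, x = s ∨ x = t)
    (hM : A.m s t = (M : ℕ∞)) (h : IsRel A u v) : u.length = M := by
  obtain ⟨x, y, k, hxy, hk, rfl, -⟩ := h
  rw [length_altWord, ← Nat.cast_inj (R := ℕ∞), ← hk, ← hM]
  rcases hdih x with rfl | rfl <;> rcases hdih y with rfl | rfl
  · exact absurd rfl hxy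
  · rfl
  · exact A.symm _ _
  · exact absurd rfl hxy

theorem length_wordInv : (wordInv v).length = v.length := by simp [wordInv]

theorem wordInv_reverse : wordInv v.reverse = (wordInv v).reverse := by simp [wordInv]

theorem head?_wordInv : (wordInv v).head? = v.getLast?.map fun l => (l.1, !l.2) := by
  simp [wordInv]

theorem getLast?_wordInv : (wordInv v).getLast? = v.head?.map fun l => (l.1, !l.2) := by
  simp [wordInv]

/-! ### Reversal of special transformations -/

theorem isLCSuffix_iff_reverse {p x y : Word S} :
    IsLCSuffix p x y ↔ IsLCPrefix p.reverse x.reverse y.reverse := by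
  simp only [IsLCSuffix, IsLCPrefix, List.reverse_prefix, List.length_reverse]
  refine and_congr_right fun _ => and_congr_right fun _ =>
    ⟨fun h q hx hy => ?_, fun h q hx hy => ?_⟩
  · simpa using h q.reverse (by simpa using List.reverse_suffix.2 hx)
      (by simpa using List.reverse_suffix.2 hy)
  · simpa using h q.reverse (List.reverse_prefix.2 hx) (List.reverse_prefix.2 hy)

theorem IsLCPrefix.head_ne {p x y : Word S} (h : IsLCPrefix p (p ++ x) (p ++ y)) :
    ∀ a ∈ x.head?, a ∉ y.head? := by
  intro a ha hb
  cases x with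
  | nil => simp at ha
  | cons c x =>
    cases y with
    | nil => simp at hb
    | cons d y =>
      simp only [List.head?_cons, Option.mem_def, Option.some.injEq] at ha hb
      subst ha
      subst hb
      have := h.2.2 (p ++ [d]) ⟨x, by simp⟩ ⟨y, by simp⟩
      simp at this

theorem isLCPrefix_of_head_ne {p x y : Word S} (h : ∀ a ∈ x.head?, a ∉ y.head?) :
    IsLCPrefix p (p ++ x) (p ++ y) := by
  refine ⟨List.prefix_append _ _, List.prefix_append _ _, fun q hx hy => ?_⟩
  by_contra! hlt
  obtain ⟨r, rfl⟩ := List.prefix_of_prefix_length_le (List.prefix_append p x) hx hlt.le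
  rw [List.prefix_append_right_inj] at hx hy
  obtain ⟨x, rfl⟩ := hx
  obtain ⟨y, rfl⟩ := hy
  cases r with
  | nil => simp at hlt
  | cons a r => exact h a (by simp) (by simp)

theorem isLCSuffix_of_getLast_ne {p x y : Word S} (h : ∀ a ∈ x.getLast?, a ∉ y.getLast?) :
    IsLCSuffix p (x ++ p) (y ++ p) := by
  rw [isLCSuffix_iff_reverse, List.reverse_append, List.reverse_append]
  exact isLCPrefix_of_head_ne (by simpa using h)

theorem Step2lStar.reverse {w w' : Word S} (h : Step2lStar A w w') :
    Step2rStar A w.reverse w'.reverse := by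
  obtain ⟨w₁, w₂, v, u, v', u', hrel, hv, hv', rfl, rfl, hl, hl'⟩ := h
  refine ⟨w₂.reverse, w₁.reverse, v'.reverse, u'.reverse, v.reverse, u.reverse, ?_,
    by simpa using hv', by simpa using hv, ?_, ?_, ?_, ?_⟩
  · simpa using hrel.symm.reverse
  · simp [wordInv_reverse]
  · simp [wordInv_reverse]
  · simpa [isLCSuffix_iff_reverse, wordInv_reverse] using hl'
  · simpa [isLCSuffix_iff_reverse] using hl

theorem Step2lStar.of_reverse {w w' : Word S} (h : Step2lStar A w.reverse w'.reverse) :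
    Step2rStar A w w' := by
  simpa using h.reverse

theorem Step2rStar.omega_and_reverse_step {w w' : Word S} {s t : S} {M : ℕ}
    (hdih : ∀ x : S, x = s ∨ x = t) (hM : A.m s t = (M : ℕ∞)) (hw : Omega M w)
    (h : Step2rStar A w w') : Omega M w' ∧ Step2lStar A w' w := by
  obtain ⟨w₁, w₂, v, u, v', u', hrel, hv, hv', rfl, rfl, hl, hl'⟩ := h
  rw [omega_iff] at hw ⊢
  obtain ⟨hred, hruns⟩ := hw
  have two_gen : ∀ {a b c : S}, a ≠ b → c = a ∨ c = b := by
    intro a b c hab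
    rcases hdih a with rfl | rfl <;> rcases hdih b with rfl | rfl <;>
      rcases hdih c with rfl | rfl <;> simp_all
  have hlen := hrel.length_eq hdih hM
  have hlen' := hrel.symm.length_eq hdih hM
  rw [List.length_append] at hlen hlen'
  obtain ⟨hcv, hcu, hvu⟩ := List.isChain_append.1 hrel.isChain
  obtain ⟨hcv', hcu', hvu'⟩ := List.isChain_append.1 hrel.symm.isChain
  have hvlt : v.length < M := by
    rw [← length_wordInv]
    exact hruns _ ⟨w₁, v' ++ w₂, by simp⟩ (isChain_alternating_wordInv.2 hcv)
  have hvlt' : v'.length < M := hruns _ ⟨w₁ ++ wordInv v, w₂, by simp⟩ hcv'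
  have hu : u ≠ [] := by rintro rfl; simp at hlen; omega
  have hu' : u' ≠ [] := by rintro rfl; simp at hlen'; omega
  have hpos := hrel.positive
  have hpos' := hrel.symm.positive
  -- the letters around the junctions of the replaced factor
  obtain ⟨v₀, c, rfl⟩ := (List.eq_nil_or_concat' v).resolve_left hv
  obtain ⟨v₀', c', rfl⟩ := (List.eq_nil_or_concat' v').resolve_left hv'
  obtain ⟨d, u₀, rfl⟩ := List.exists_cons_of_ne_nil hu
  obtain ⟨d', u₀', rfl⟩ := List.exists_cons_of_ne_nil hu'
  have hc : c.2 = true := hpos c (by simp)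
  have hd : d.2 = true := hpos d (by simp)
  have hc' : c'.2 = true := hpos' c' (by simp)
  have hd' : d'.2 = true := hpos' d' (by simp)
  have hcd : c.1 ≠ d.1 := (hvu c (by simp) d (by simp)).2
  have hcd' : c'.1 ≠ d'.1 := (hvu' c' (by simp) d' (by simp)).2
  have hleft : ∀ a ∈ w₁.getLast?, a = (c.1, false) ∨ a = (d.1, true) := by
    intro a ha
    have h₁ : NoCancel a (c.1, false) := by
      have := (List.isChain_append.1 (hred.left_of_append.left_of_append)).2.2 a ha
        (c.1, !c.2) (by simp [head?_wordInv])
      simpa [hc] using this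
    have h₂ : a ≠ (d.1, false) := by
      rintro rfl
      refine hl.head_ne d (by simp) ?_
      rw [head?_wordInv, Option.mem_def.1 ha]
      simp [← hd]
    obtain ⟨x, b⟩ := a
    rcases two_gen (c := x) hcd with rfl | rfl <;> cases b <;> simp_all [NoCancel]
  have hright : ∀ a ∈ w₂.head?, a = (c'.1, true) ∨ a = (d'.1, false) := by
    intro a ha
    have h₁ : NoCancel c' a :=
      (List.isChain_append.1 hred).2.2 c' (by rw [← List.append_assoc]; simp) a ha
    have h₂ : a ≠ (d'.1, true) := by
      rintro rfl
      refine hl'.head_ne d' (by simp) ?_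
      rw [← hd'] at ha
      exact ha
    obtain ⟨x, b⟩ := a
    rcases two_gen (c := x) hcd' with rfl | rfl <;> cases b <;> simp_all [NoCancel]
  have hmid : ∀ a ∈ (d :: u₀).getLast?, ∀ b ∈ (wordInv (d' :: u₀')).head?,
      NoCancel a b ∧ ¬ Alternating a b := by
    intro a ha b hb
    rw [head?_wordInv, Option.mem_map] at hb
    obtain ⟨b, hb, rfl⟩ := hb
    have ha₂ : a.2 = true :=
      hpos a (List.mem_append_right _ (List.mem_of_getLast? ha))
    have hb₂ : b.2 = true :=
      hpos' b (List.mem_append_right _ (List.mem_of_getLast? hb))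
    have hab : a.1 ≠ b.1 := hrel.getLast_ne a (by rw [List.getLast?_append, ha]; rfl) b
      (by rw [List.getLast?_append, hb]; rfl)
    simp [NoCancel, Alternating, hab, ha₂, hb₂]
  have hj₁ : ∀ a ∈ w₁.getLast?, ∀ b ∈ (d :: u₀).head?, NoCancel a b ∧ ¬ Alternating a b := by
    intro a ha b hb
    simp only [List.head?_cons, Option.mem_def, Option.some.injEq] at hb
    subst hb
    rcases hleft a ha with rfl | rfl <;> simp [NoCancel, Alternating, hd, hcd]
  have hj₂ : ∀ a ∈ (w₁ ++ (d :: u₀) ++ wordInv (d' :: u₀')).getLast?, ∀ b ∈ w₂.head?,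
      NoCancel a b ∧ ¬ Alternating a b := by
    intro a ha b hb
    have ha : a = (d'.1, false) := by
      rw [List.getLast?_append, getLast?_wordInv] at ha
      simpa [hd', eq_comm] using ha
    subst ha
    rcases hright b hb with rfl | rfl <;> simp [NoCancel, Alternating, hcd'.symm]
  have hmid' : ∀ a ∈ (w₁ ++ (d :: u₀)).getLast?, ∀ b ∈ (wordInv (d' :: u₀')).head?,
      NoCancel a b ∧ ¬ Alternating a b := by
    intro a ha
    exact hmid a (by simpa [List.getLast?_append, List.getLast?_cons] using ha)
  have hw₁ : w₁ <:+: w₁ ++ wordInv (v₀ ++ [c]) ++ (v₀' ++ [c']) ++ w₂ := ⟨[], _, by simp; rfl⟩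
  have hw₂ : w₂ <:+: w₁ ++ wordInv (v₀ ++ [c]) ++ (v₀' ++ [c']) ++ w₂ :=
    (List.suffix_append _ _).isInfix
  have runs_u : RunsLt M (d :: u₀) := fun x hx _ => hx.length_le.trans_lt (by simp at hlen; simp; omega)
  have runs_u' : RunsLt M (wordInv (d' :: u₀')) := fun x hx _ =>
    hx.length_le.trans_lt (by simp at hlen'; simp [length_wordInv]; omega)
  refine ⟨⟨?_, ?_⟩, ?_⟩
  · refine List.isChain_append.2 ⟨List.isChain_append.2 ⟨List.isChain_append.2
      ⟨hred.infix hw₁, hcu.imp fun _ _ h => h.noCancel, fun a ha b hb => (hj₁ a ha b hb).1⟩,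
      (isChain_alternating_wordInv.2 hcu').imp fun _ _ h => h.noCancel,
      fun a ha b hb => (hmid' a ha b hb).1⟩, hred.infix hw₂, fun a ha b hb => (hj₂ a ha b hb).1⟩
  · exact (((hruns.factor hw₁).append runs_u fun a ha b hb => (hj₁ a ha b hb).2).append runs_u'
      fun a ha b hb => (hmid' a ha b hb).2).append (hruns.factor hw₂)
      fun a ha b hb => (hj₂ a ha b hb).2
  · refine ⟨w₁, w₂, d :: u₀, v₀ ++ [c], d' :: u₀', v₀' ++ [c'], hrel, hu, hu', rfl, rfl,
      isLCSuffix_of_getLast_ne ?_, isLCSuffix_of_getLast_ne ?_⟩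
    · intro a ha ha'
      have ha : a = c := by simpa [eq_comm] using ha
      subst ha
      rcases hleft _ ha' with h | h
      · rw [h] at hc
        simp at hc
      · exact hcd (by rw [h])
    · intro a ha ha'
      have ha : a = c' := by simpa [eq_comm] using ha
      subst ha
      rw [getLast?_wordInv, Option.mem_map] at ha'
      obtain ⟨b, hb, rfl⟩ := ha'
      rcases hright _ hb with h | h
      · rw [Prod.ext_iff] at h
        simp [h.2] at hc'
      · exact hcd' (by rw [h])

theorem Step2Star.omega_and_symm {w w' : Word S} {s t : S} {M : ℕ}
    (hdih : ∀ x : S, x = s ∨ x = t) (hM : A.m s t = (M : ℕ∞)) (hw : Omega M w)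
    (h : Step2Star A w w') : Omega M w' ∧ Step2Star A w' w := by
  rcases h with h | h
  · obtain ⟨h₁, h₂⟩ := h.omega_and_reverse_step hdih hM hw
    exact ⟨h₁, Or.inr h₂⟩
  · obtain ⟨h₁, h₂⟩ := h.reverse.omega_and_reverse_step hdih hM hw.reverse
    exact ⟨by simpa using h₁.reverse, Or.inl h₂.of_reverse⟩

theorem Steps2Star.omega_and_symm {w w' : Word S} {s t : S} {M : ℕ}
    (hdih : ∀ x : S, x = s ∨ x = t) (hM : A.m s t = (M : ℕ∞)) (hw : Omega M w)
    (h : Steps2Star A w w') : Omega M w' ∧ Steps2Star A w' w := by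
  induction h with
  | refl => exact ⟨hw, .refl⟩
  | tail _ hstep ih =>
    obtain ⟨h₁, h₂⟩ := hstep.omega_and_symm hdih hM ih.1
    exact ⟨h₁, .head h₂ ih.2⟩

/-- Corollary 2.7: in a dihedral Artin–Tits group with `m < ∞`, `Ω(Γ₀)` is
closed under type `2⋆` operations, and on `Ω(Γ₀)` the relation `→_{2⋆}` is symmetric. -/
theorem stmt3 {S : Type*} [Finite S] (A : ArtinData S) (s t : S) (M : ℕ)
    (hst : s ≠ t) (hdih : ∀ x : S, x = s ∨ x = t) (hM : A.m s t = (M : ℕ∞)) :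
    (∀ w w' : Word S, Omega M w → Step2Star A w w' → Omega M w') ∧
      ∀ w w' : Word S, Omega M w → Omega M w' →
        (Steps2Star A w w' ↔ Steps2Star A w' w) := by
  exact ⟨fun w w' hw h => (h.omega_and_symm hdih hM hw).1, fun w w' hw hw' =>
    ⟨fun h => (h.omega_and_symm hdih hM hw).2, fun h => (h.omega_and_symm hdih hM hw').2⟩⟩

end ArtinTits
end

section
/- Let A(Γ₀) be a dihedral Artin-Tits group with m < ∞, and let w and w' be words belonging to Ω(Γ₀). Then w →_{2⋆} w' if and only if w and w' represent the same element of A(Γ₀). -/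
namespace ArtinTits

open Classical List

variable {S : Type*}

/-! ### Garside normal forms in the dihedral case

The normal form `w Δ ^ r` of an element, where `w` is a positive word without alternating factor
of length `M`, is encoded by `r`, the first letter of `w` and the lengths of the successive maximal
alternating factors of `w`. The two generators are indexed by `Bool`. -/

/-- Raw normal forms `(r, c, L)`: exponent of `Δ`, first letter and lengths of the blocks. -/
abbrev RawNF := ℤ × Bool × List ℕ

/-- The normal form with given data, the first letter being irrelevant without blocks. -/
def mkNF (r : ℤ) (c : Bool) (L : List ℕ) : RawNF := (r, c || L.isEmpty, L)

@[simp] lemma mkNF_nil (r : ℤ) (c : Bool) : mkNF r c [] = (r, true, []) := by simp [mkNF]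

@[simp] lemma mkNF_cons (r : ℤ) (c : Bool) (l : ℕ) (L : List ℕ) :
    mkNF r c (l :: L) = (r, c, l :: L) := by simp [mkNF]

/-- Left multiplication of a normal form by the generator `a`. -/
def pushNF (M : ℕ) (a : Bool) : RawNF → RawNF
  | (r, _, []) => (r, a, [1])
  | (r, c, l :: L) =>
    if a = c then (r, a, 1 :: l :: L)
    else if l + 1 < M then (r, a, (l + 1) :: L) else mkNF (r + 1) c L

/-- Left multiplication of a normal form by the inverse of the generator `a`. -/
def popNF (M : ℕ) (a : Bool) : RawNF → RawNF
  | (r, _, []) => (r - 1, !a, [M - 1])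
  | (r, c, l :: L) =>
    if a = c then (if l = 1 then mkNF r c L else (r, !c, (l - 1) :: L))
    else (r - 1, c, (M - 1) :: l :: L)

lemma pushNF_cons (M : ℕ) (a : Bool) (r : ℤ) (c : Bool) (l : ℕ) (L : List ℕ) :
    pushNF M a (r, c, l :: L) = if a = c then (r, a, 1 :: l :: L)
      else if l + 1 < M then (r, a, (l + 1) :: L) else mkNF (r + 1) c L := rfl

lemma popNF_cons (M : ℕ) (a : Bool) (r : ℤ) (c : Bool) (l : ℕ) (L : List ℕ) :
    popNF M a (r, c, l :: L) =
      if a = c then (if l = 1 then mkNF r c L else (r, !c, (l - 1) :: L))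
      else (r - 1, c, (M - 1) :: l :: L) := rfl

/-- Validity of a raw normal form. -/
def ValidNF (M : ℕ) (x : RawNF) : Prop :=
  (x.2.2 = [] → x.2.1 = true) ∧ ∀ l ∈ x.2.2, 1 ≤ l ∧ l < M

lemma validNF_mkNF {M : ℕ} {r : ℤ} {c : Bool} {L : List ℕ} (h : ∀ l ∈ L, 1 ≤ l ∧ l < M) :
    ValidNF M (mkNF r c L) := by
  refine ⟨fun h0 => ?_, h⟩
  have : L = [] := h0
  simp [this]

lemma ValidNF.pushNF {M : ℕ} (hM : 2 ≤ M) (a : Bool) {x : RawNF} (hx : ValidNF M x) :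
    ValidNF M (pushNF M a x) := by
  obtain ⟨r, c, _ | ⟨l, L⟩⟩ := x
  · simp [ArtinTits.pushNF, ValidNF]; omega
  · have h1 := hx.2
    simp only [List.mem_cons, forall_eq_or_imp] at h1
    rw [pushNF_cons]
    split_ifs
    · simp [ValidNF]; exact ⟨by omega, h1.1, h1.2⟩
    · simp [ValidNF]; exact ⟨by omega, h1.2⟩
    · exact validNF_mkNF h1.2

lemma ValidNF.popNF {M : ℕ} (hM : 2 ≤ M) (a : Bool) {x : RawNF} (hx : ValidNF M x) :
    ValidNF M (popNF M a x) := by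
  obtain ⟨r, c, _ | ⟨l, L⟩⟩ := x
  · simp [ArtinTits.popNF, ValidNF]; omega
  · have h1 := hx.2
    simp only [List.mem_cons, forall_eq_or_imp] at h1
    rw [popNF_cons]
    split_ifs
    · exact validNF_mkNF h1.2
    · simp [ValidNF]; exact ⟨by omega, h1.2⟩
    · simp [ValidNF]; exact ⟨by omega, h1.1, h1.2⟩

lemma pop_pushNF {M : ℕ} (a : Bool) {x : RawNF} (hx : ValidNF M x) :
    popNF M a (pushNF M a x) = x := by
  obtain ⟨r, c, _ | ⟨l, L⟩⟩ := x
  · have := hx.1 rfl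
    simp at this
    simp [pushNF, popNF, this]
  · have h1 := hx.2
    simp only [List.mem_cons, forall_eq_or_imp] at h1
    rw [pushNF_cons]
    split_ifs with h2 h3
    · subst h2; simp [popNF]
    · have : l ≠ 0 := by omega
      have : c = !a := by cases a <;> cases c <;> simp_all
      simp [popNF, *]
    · have h4 : M - 1 = l := by omega
      have h5 : c = !a := by cases a <;> cases c <;> simp_all
      cases L <;> simp [popNF, h4, h5]

lemma push_popNF {M : ℕ} (hM : 2 ≤ M) (a : Bool) {x : RawNF} (hx : ValidNF M x) :
    pushNF M a (popNF M a x) = x := by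
  have hM1 : M - 1 + 1 = M := by omega
  obtain ⟨r, c, _ | ⟨l, L⟩⟩ := x
  · have := hx.1 rfl
    simp at this
    simp [pushNF, popNF, this, hM1]
  · have h1 := hx.2
    simp only [List.mem_cons, forall_eq_or_imp] at h1
    rw [popNF_cons]
    split_ifs with h2 h3
    · subst h2; cases L <;> simp [pushNF, h3]
    · have h4 : l - 1 + 1 = l := by omega
      subst h2
      simp [pushNF, h4, h1.1.2]
    · simp [pushNF, h2, hM1]

/-- Left multiplication of a normal form by the alternating positive word of length `k` beginning
with `c`. -/
def pushAlt (M : ℕ) : Bool → ℕ → RawNF → RawNF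
  | _, 0, x => x
  | c, k + 1, x => pushNF M c (pushAlt M (!c) k x)

lemma pushAlt_add (M : ℕ) (c : Bool) (i j : ℕ) (x : RawNF) :
    pushAlt M c (i + j) x = pushAlt M c i (pushAlt M (c ^^ i.bodd) j x) := by
  induction i generalizing c with
  | zero => simp [pushAlt]
  | succ i ih =>
    rw [Nat.succ_add]
    simp only [pushAlt, ih]
    congr 3
    cases c <;> simp

lemma pushAlt_one (M : ℕ) (c : Bool) (x : RawNF) : pushAlt M c 1 x = pushNF M c x := rfl

lemma pushNF_mkNF (M : ℕ) (a : Bool) (r : ℤ) (L : List ℕ) :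
    pushNF M a (mkNF r a L) = (r, a, 1 :: L) := by
  cases L <;> simp [pushNF]

lemma pushAlt_cons {M : ℕ} {c c' : Bool} {k l : ℕ} {r : ℤ} {L : List ℕ} (hk : l + k < M)
    (hc : c' = (c ^^ k.bodd)) :
    pushAlt M c k (r, c', l :: L) = (r, c, (l + k) :: L) := by
  induction k generalizing c with
  | zero => simp_all [pushAlt]
  | succ k ih =>
    rw [pushAlt, ih (by omega) (by rw [hc]; cases c <;> simp)]
    rw [pushNF_cons, if_neg (by simp), if_pos (by omega), Nat.add_assoc]

lemma pushAlt_mkNF {M : ℕ} {c c' : Bool} {k : ℕ} {r : ℤ} {L : List ℕ} (hk : k + 1 < M)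
    (hc : c' = (c ^^ k.bodd)) :
    pushAlt M c (k + 1) (mkNF r c' L) = (r, c, (k + 1) :: L) := by
  rw [pushAlt_add, ← hc, pushAlt, pushAlt]
  rw [pushNF_mkNF, pushAlt_cons (by omega) hc, Nat.add_comm]

lemma pushNF_drop {M : ℕ} {c c' : Bool} {l : ℕ} {r : ℤ} {L : List ℕ} (hl : M ≤ l + 1)
    (hc : c ≠ c') : pushNF M c (r, c', l :: L) = mkNF (r + 1) c' L := by
  simp [pushNF, hc]; omega

lemma pushAlt_delta {M : ℕ} (hM : 2 ≤ M) (c : Bool) {x : RawNF} (hx : ValidNF M x) :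
    pushAlt M c M x = mkNF (x.1 + 1) (x.2.1 ^^ M.bodd) x.2.2 := by
  obtain ⟨r, c', L⟩ := x
  have hx' : (r, c', L) = mkNF r c' L := by
    cases L with
    | nil => have := hx.1 rfl; simp at this; simp [this]
    | cons => simp
  obtain ⟨k, rfl⟩ : ∃ k, M = k + 2 := ⟨M - 2, by omega⟩
  by_cases hc : L = [] ∨ c' = ((!c) ^^ k.bodd)
  · have hx2 : (r, c', L) = mkNF r ((!c) ^^ k.bodd) L := by
      rcases hc with rfl | hc
      · simp [hx']
      · rw [← hc, hx']
    change pushAlt _ _ _ _ = mkNF (r + 1) (c' ^^ (k + 2).bodd) L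
    rw [hx2, pushAlt, pushAlt_mkNF (by omega) rfl, pushNF_drop (by omega) (by simp)]
    rcases hc with rfl | hc
    · simp
    · simp [hc]
  · push Not at hc
    obtain ⟨hL, hc⟩ := hc
    cases L with
    | nil => exact absurd rfl hL
    | cons l L =>
      have h1 := hx.2
      simp only [List.mem_cons, forall_eq_or_imp] at h1
      obtain ⟨e, rfl⟩ : ∃ e, l = e + 1 := ⟨l - 1, by omega⟩
      obtain ⟨d, rfl⟩ : ∃ d, k = e + d := ⟨k - e, by omega⟩
      have hc2 : c = (c' ^^ (e + d).bodd) := by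
        cases c <;> cases c' <;> cases h : (e + d).bodd <;> simp_all
      rw [show e + d + 2 = (e + 1) + (1 + d) by omega, pushAlt_add (i := e + 1),
        pushAlt_add (i := 1), pushAlt_cons (by omega) (c' := c'), pushAlt_one,
        pushNF_drop (by omega), pushAlt_mkNF (by omega)]
      · simp
        rw [hc2]
        cases c' <;> simp
      all_goals
        subst hc2
        cases c' <;> cases h : e.bodd <;> cases h' : d.bodd <;> simp [h, h']

lemma popNF_mkNF {M : ℕ} (a : Bool) (r : ℤ) (L : List ℕ) :
    popNF M (!a) (mkNF r a L) = (r - 1, a, (M - 1) :: L) := by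
  cases L <;> simp [popNF]

/-- Valid normal forms. -/
abbrev NF (M : ℕ) := {x : RawNF // ValidNF M x}

/-- The permutation of normal forms induced by a generator. -/
def genPerm {M : ℕ} (hM : 2 ≤ M) (a : Bool) : Equiv.Perm (NF M) where
  toFun x := ⟨pushNF M a x.1, x.2.pushNF hM a⟩
  invFun x := ⟨popNF M a x.1, x.2.popNF hM a⟩
  left_inv x := Subtype.ext (pop_pushNF a x.2)
  right_inv x := Subtype.ext (push_popNF hM a x.2)

/-! ### Words as sequences of alternating blocks -/

/-- The alternating word of sign `b` and length `k` beginning with the generator of index `c`. -/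
def run (s t : S) (c b : Bool) : ℕ → Word S
  | 0 => []
  | k + 1 => (cond c s t, b) :: run s t (!c) b k

/-- The word whose block decomposition is given by the signs and lengths in the list; positive
blocks begin with the current letter, negative blocks with the other one. -/
def ofBlocks (s t : S) : Bool → List (Bool × ℕ) → Word S
  | _, [] => []
  | c, (b, l) :: L => run s t (c ^^ !b) b l ++ ofBlocks s t (c ^^ !l.bodd) L

/-- The letter which follows a sequence of blocks. -/
def endLetter : Bool → List (Bool × ℕ) → Bool
  | c, [] => c
  | c, (_, l) :: L => endLetter (c ^^ !l.bodd) L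

@[simp] lemma length_run (s t : S) (c b : Bool) (k : ℕ) : (run s t c b k).length = k := by
  induction k generalizing c with
  | zero => rfl
  | succ k ih => simp [run, ih]

lemma run_ne_nil (s t : S) (c b : Bool) {k : ℕ} (hk : 1 ≤ k) : run s t c b k ≠ [] := by
  rw [← List.length_pos_iff]; simpa

lemma run_add (s t : S) (c b : Bool) (i j : ℕ) :
    run s t c b (i + j) = run s t c b i ++ run s t (c ^^ i.bodd) b j := by
  induction i generalizing c with
  | zero => simp [run]
  | succ i ih =>
    rw [Nat.succ_add]
    simp only [run, ih, List.cons_append]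
    congr 3
    cases c <;> simp

lemma altWord_eq_run (s t : S) (c : Bool) (k : ℕ) :
    altWord (cond c s t) (cond (!c) s t) k = run s t c true k := by
  induction k generalizing c with
  | zero => rfl
  | succ k ih => rw [altWord, run, ← ih, Bool.not_not]

lemma wordInv_append (u v : Word S) : wordInv (u ++ v) = wordInv v ++ wordInv u := by
  simp [wordInv]

lemma wordInv_run (s t : S) (c b : Bool) (k : ℕ) :
    wordInv (run s t c b k) = run s t (c ^^ !k.bodd) (!b) k := by
  induction k generalizing c with
  | zero => rfl
  | succ k ih =>
    rw [run_add (i := k), wordInv_append, ih, Nat.add_comm, run_add (i := 1)]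
    cases c <;> cases h : k.bodd <;> simp [run, wordInv, h]

lemma mem_run {s t : S} {c b : Bool} {k : ℕ} {x : S × Bool} (hx : x ∈ run s t c b k) :
    x.2 = b := by
  induction k generalizing c with
  | zero => simp [run] at hx
  | succ k ih =>
    simp only [run, List.mem_cons] at hx
    rcases hx with rfl | hx
    · rfl
    · exact ih hx

lemma squareFree_run {s t : S} (hst : s ≠ t) (c b : Bool) (k : ℕ) :
    SquareFree (run s t c b k) := by
  have hch : (run s t c b k).IsChain (· ≠ ·) := by
    induction k generalizing c with
    | zero => simp [run]
    | succ k ih =>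
      cases k with
      | zero => simp [run]
      | succ k =>
        have := ih (!c)
        simp only [run] at this ⊢
        refine List.IsChain.cons_cons ?_ this
        cases c <;> simp [hst, hst.symm]
  intro a ha
  obtain ⟨u, v, huv⟩ := ha
  rw [← huv] at hch
  simpa using hch.left_of_append.right_of_append

lemma head?_ofBlocks {s t : S} {c : Bool} {L : List (Bool × ℕ)} (hL : ∀ x ∈ L, 1 ≤ x.2)
    {y : S × Bool} (hy : (ofBlocks s t c L).head? = some y) :
    y = (cond (c ^^ !y.2) s t, y.2) := by
  cases L with
  | nil => simp [ofBlocks] at hy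
  | cons x L =>
    obtain ⟨b, l⟩ := x
    simp only [List.mem_cons, forall_eq_or_imp] at hL
    obtain ⟨k, rfl⟩ : ∃ k, l = k + 1 := ⟨l - 1, by omega⟩
    simp [ofBlocks, run] at hy
    subst hy
    simp

lemma getLast?_run_succ (s t : S) (c b : Bool) (k : ℕ) :
    (run s t c b (k + 1)).getLast? = some (cond (c ^^ k.bodd) s t, b) := by
  rw [run_add]
  simp [run]

lemma getLast?_ofBlocks {s t : S} {c : Bool} {L : List (Bool × ℕ)} (hL : ∀ x ∈ L, 1 ≤ x.2)
    {y : S × Bool} (hy : (ofBlocks s t c L).getLast? = some y) :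
    y = (cond (endLetter c L ^^ !y.2) s t, y.2) := by
  induction L generalizing c with
  | nil => simp [ofBlocks] at hy
  | cons x L ih =>
    obtain ⟨b, l⟩ := x
    simp only [List.mem_cons, forall_eq_or_imp] at hL
    rw [ofBlocks, List.getLast?_append] at hy
    cases h : (ofBlocks s t (c ^^ !l.bodd) L).getLast? with
    | some z =>
      simp only [h, Option.some_or, Option.some.injEq] at hy
      subst hy
      exact ih hL.2 h
    | none =>
      rw [h, Option.none_or] at hy
      have hL0 : L = [] := by
        cases L with
        | nil => rfl
        | cons z L =>
          simp only [List.mem_cons, forall_eq_or_imp] at hL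
          rw [List.getLast?_eq_none_iff, ofBlocks, List.append_eq_nil_iff] at h
          exact absurd h.1 (run_ne_nil _ _ _ _ hL.2.1)
      subst hL0
      obtain ⟨k, rfl⟩ : ∃ k, l = k + 1 := ⟨l - 1, by omega⟩
      rw [getLast?_run_succ, Option.some.injEq] at hy
      subst hy
      cases c <;> cases b <;> cases h' : k.bodd <;> simp [endLetter, h']

lemma ofBlocks_append (s t : S) (c : Bool) (L L' : List (Bool × ℕ)) :
    ofBlocks s t c (L ++ L') = ofBlocks s t c L ++ ofBlocks s t (endLetter c L) L' := by
  induction L generalizing c with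
  | nil => rfl
  | cons x L ih => simp [ofBlocks, endLetter, ih]

lemma FreelyReduced.tail {x : S × Bool} {w : Word S} (h : FreelyReduced (x :: w)) :
    FreelyReduced w := by
  intro w₁ w₂ a b hw
  exact h (x :: w₁) w₂ a b (by simp [hw])

lemma exists_ofBlocks {s t : S} (hst : s ≠ t) (hdih : ∀ x : S, x = s ∨ x = t) (w : Word S)
    (hw : FreelyReduced w) :
    ∃ (c : Bool) (L : List (Bool × ℕ)), (∀ x ∈ L, 1 ≤ x.2) ∧ w = ofBlocks s t c L := by
  induction w with
  | nil => exact ⟨true, [], by simp, rfl⟩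
  | cons x w ih =>
    obtain ⟨c, L, hL, rfl⟩ := ih hw.tail
    obtain ⟨g, b⟩ := x
    obtain ⟨a, rfl⟩ : ∃ a : Bool, g = cond (a ^^ !b) s t := by
      rcases hdih g with rfl | rfl
      · exact ⟨b, by simp⟩
      · exact ⟨!b, by simp⟩
    have hnew : a = c ∨ L = [] → ∃ (c' : Bool) (L' : List (Bool × ℕ)), (∀ x ∈ L', 1 ≤ x.2) ∧
        (cond (a ^^ !b) s t, b) :: ofBlocks s t c L = ofBlocks s t c' L' := by
      intro h
      refine ⟨a, (b, 1) :: L, by simpa using hL, ?_⟩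
      rcases h with rfl | rfl <;> simp [ofBlocks, run]
    cases L with
    | nil => exact hnew (Or.inr rfl)
    | cons y L =>
      by_cases hac : a = c
      · exact hnew (Or.inl hac)
      · obtain ⟨b', l⟩ := y
        simp only [List.mem_cons, forall_eq_or_imp] at hL
        obtain ⟨k, rfl⟩ : ∃ k, l = k + 1 := ⟨l - 1, by omega⟩
        have hca : c = !a := by cases a <;> cases c <;> simp_all
        by_cases hb : b' = b
        · subst hb
          refine ⟨a, (b', k + 2) :: L, by simpa using hL.2, ?_⟩
          subst hca
          cases a <;> cases b' <;> simp [ofBlocks, run]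
        · have hb' : b' = !b := by cases b <;> cases b' <;> simp_all
          subst hb' hca
          refine absurd ?_ (hw [] (run s t (!(!a ^^ b)) (!b) k ++
            ofBlocks s t (!a ^^ !(k + 1).bodd) L) (cond (a ^^ !b) s t) b)
          cases a <;> cases b <;> simp [ofBlocks, run]

lemma run_isFactor_ofBlocks {s t : S} {c b : Bool} {l : ℕ} {L : List (Bool × ℕ)}
    (h : (b, l) ∈ L) : ∃ c', run s t c' b l <:+: ofBlocks s t c L := by
  induction L generalizing c with
  | nil => simp at h
  | cons x L ih =>
    rcases List.mem_cons.1 h with rfl | h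
    · exact ⟨_, [], _, rfl⟩
    · obtain ⟨c', u, v, huv⟩ := ih (c := c ^^ !x.2.bodd) h
      exact ⟨c', run s t (c ^^ !x.1) x.1 x.2 ++ u, v, by rw [ofBlocks, ← huv]; simp only [List.append_assoc]⟩

lemma length_le_ptilde {v w : Word S} (h : v <:+: w) (h1 : Positive v) (h2 : SquareFree v) :
    v.length ≤ ptilde w := by
  refine le_csSup ⟨w.length, ?_⟩ ⟨v, h, h1, h2, rfl⟩
  rintro _ ⟨u, hu, -, -, rfl⟩
  exact hu.length_le

lemma length_le_ntilde {v w : Word S} (h : v <:+: w) (h1 : Negative v)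
    (h2 : SquareFree (wordInv v)) : v.length ≤ ntilde w := by
  refine le_csSup ⟨w.length, ?_⟩ ⟨v, h, h1, h2, rfl⟩
  rintro _ ⟨u, hu, -, -, rfl⟩
  exact hu.length_le

/-- A word of `Ω` is a sequence of blocks of lengths between `1` and `M - 1`. -/
lemma Omega.exists_ofBlocks {s t : S} (hst : s ≠ t) (hdih : ∀ x : S, x = s ∨ x = t) {M : ℕ}
    {w : Word S} (hw : Omega M w) :
    ∃ (c : Bool) (L : List (Bool × ℕ)), (∀ x ∈ L, 1 ≤ x.2 ∧ x.2 < M) ∧ w = ofBlocks s t c L := by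
  obtain ⟨c, L, hL, rfl⟩ := ArtinTits.exists_ofBlocks hst hdih w hw.1
  refine ⟨c, L, fun x hx => ⟨hL x hx, ?_⟩, rfl⟩
  obtain ⟨b, l⟩ := x
  obtain ⟨c', hc'⟩ := run_isFactor_ofBlocks (s := s) (t := t) (c := c) hx
  have hlt := hw.2
  simp only [pfun, nfun, max_lt_iff, min_lt_iff, lt_irrefl, or_false] at hlt
  cases b with
  | true =>
    refine lt_of_le_of_lt ?_ hlt.1
    simpa using length_le_ptilde hc' (fun x hx => mem_run hx) (squareFree_run hst _ _ _)
  | false =>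
    refine lt_of_le_of_lt ?_ hlt.2
    simpa using length_le_ntilde hc' (fun x hx => mem_run hx)
      (by rw [wordInv_run]; exact squareFree_run hst _ _ _)

/-! ### Exchanging the signs of adjacent blocks -/

/-- Exchange of the signs of two adjacent blocks. -/
def BlockSwap (M : ℕ) (P Q : List (Bool × ℕ)) : Prop :=
  ∃ (L₁ L₂ : List (Bool × ℕ)) (b : Bool) (k l : ℕ),
    P = L₁ ++ (b, k) :: (!b, l) :: L₂ ∧ Q = L₁ ++ (!b, M - k) :: (b, M - l) :: L₂

/-- The length of the block of the normal form corresponding to a signed block. -/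
def blockLength (M : ℕ) (x : Bool × ℕ) : ℕ := cond x.1 x.2 (M - x.2)

lemma BlockSwap.cons {M : ℕ} {P Q : List (Bool × ℕ)} (h : BlockSwap M P Q) (x : Bool × ℕ) :
    BlockSwap M (x :: P) (x :: Q) := by
  obtain ⟨L₁, L₂, b, k, l, rfl, rfl⟩ := h
  exact ⟨x :: L₁, L₂, b, k, l, rfl, rfl⟩

/-- The data preserved by exchanges of signs. -/
def SwapEquiv (M : ℕ) (P Q : List (Bool × ℕ)) : Prop :=
  P.map (blockLength M) = Q.map (blockLength M) ∧
    (P.map Prod.fst).count false = (Q.map Prod.fst).count false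

lemma BlockSwap.swapEquiv {M : ℕ} {P Q : List (Bool × ℕ)} (h : BlockSwap M P Q)
    (hP : ∀ x ∈ P, 1 ≤ x.2 ∧ x.2 < M) : SwapEquiv M P Q := by
  obtain ⟨L₁, L₂, b, k, l, rfl, rfl⟩ := h
  have hk := hP (b, k) (by simp)
  have hl := hP (!b, l) (by simp)
  simp only at hk hl
  constructor
  · cases b <;> simp [blockLength] <;> omega
  · cases b <;> simp

lemma BlockSwap.valid {M : ℕ} {P Q : List (Bool × ℕ)} (h : BlockSwap M P Q)
    (hP : ∀ x ∈ P, 1 ≤ x.2 ∧ x.2 < M) : ∀ x ∈ Q, 1 ≤ x.2 ∧ x.2 < M := by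
  obtain ⟨L₁, L₂, b, k, l, rfl, rfl⟩ := h
  have hk := hP (b, k) (by simp)
  have hl := hP (!b, l) (by simp)
  simp only at hk hl
  intro x hx
  simp only [List.mem_append, List.mem_cons] at hx
  rcases hx with hx | rfl | rfl | hx
  · exact hP x (by simp [hx])
  · simp only; omega
  · simp only; omega
  · exact hP x (by simp [hx])

lemma reflTransGen_blockSwap {M : ℕ} {P Q : List (Bool × ℕ)}
    (h : Relation.ReflTransGen (BlockSwap M) P Q) (hP : ∀ x ∈ P, 1 ≤ x.2 ∧ x.2 < M) :
    (∀ x ∈ Q, 1 ≤ x.2 ∧ x.2 < M) ∧ SwapEquiv M P Q := by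
  induction h with
  | refl => exact ⟨hP, rfl, rfl⟩
  | tail _ h ih =>
    have := h.swapEquiv ih.1
    exact ⟨h.valid ih.1, ih.2.1.trans this.1, ih.2.2.trans this.2⟩

lemma exists_blockSwap_head {M : ℕ} {b : Bool} {P : List (Bool × ℕ)} (hb : b ∈ P.map Prod.fst) :
    ∃ (k : ℕ) (Q : List (Bool × ℕ)), Relation.ReflTransGen (BlockSwap M) P ((b, k) :: Q) := by
  induction P with
  | nil => simp at hb
  | cons x P ih =>
    obtain ⟨a, l⟩ := x
    by_cases hab : a = b
    · subst hab
      exact ⟨l, P, .refl⟩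
    · have hab' : b = !a := by cases a <;> cases b <;> simp_all
      have hb' : b ∈ P.map Prod.fst := by
        rw [List.map_cons, List.mem_cons] at hb
        exact hb.resolve_left fun h => hab h.symm
      obtain ⟨k, Q, hQ⟩ := ih hb'
      refine ⟨M - l, (a, M - k) :: Q, ?_⟩
      refine (hQ.lift (List.cons (a, l)) fun _ _ h => h.cons _).tail ?_
      subst hab'
      exact ⟨[], Q, a, l, k, rfl, rfl⟩

lemma SwapEquiv.reflTransGen {M : ℕ} {P Q : List (Bool × ℕ)} (h : SwapEquiv M P Q)
    (hP : ∀ x ∈ P, 1 ≤ x.2 ∧ x.2 < M) (hQ : ∀ x ∈ Q, 1 ≤ x.2 ∧ x.2 < M) :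
    Relation.ReflTransGen (BlockSwap M) P Q := by
  induction Q generalizing P with
  | nil =>
    obtain rfl : P = [] := by simpa using h.1
    exact .refl
  | cons y Q ih =>
    obtain ⟨b, l⟩ := y
    have hb : b ∈ P.map Prod.fst := by
      have hlen : P.length = Q.length + 1 := by simpa using congrArg List.length h.1
      have hcount := h.2
      by_contra hb
      have hall : ∀ x ∈ P.map Prod.fst, x = !b := by
        intro x hx
        cases x <;> cases b <;> simp_all
      rw [List.eq_replicate_of_mem hall] at hcount
      have hle := List.count_le_length (a := false) (l := Q.map Prod.fst)
      cases b <;> simp [List.count_replicate] at hcount hle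
      omega
    obtain ⟨k, P', hP'⟩ := exists_blockSwap_head (M := M) hb
    refine hP'.trans ?_
    obtain ⟨hv, he⟩ := reflTransGen_blockSwap hP' hP
    have h' : SwapEquiv M ((b, k) :: P') ((b, l) :: Q) :=
      ⟨he.1.symm.trans h.1, he.2.symm.trans h.2⟩
    simp only [List.mem_cons, forall_eq_or_imp] at hv hQ
    have h1 := h'.1
    simp only [List.map_cons, List.cons.injEq] at h1
    have hkl : k = l := by
      have := h1.1
      cases b <;> simp [blockLength] at this <;> omega
    subst hkl
    refine (ih ⟨h1.2, ?_⟩ hv.2 hQ.2).lift (List.cons (b, k)) fun _ _ h => h.cons _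
    have h2 := h'.2
    simp only [List.map_cons, List.count_cons] at h2
    omega

lemma isLCPrefix_append {v u z : Word S} (h : ∀ x, u.head? = some x → z.head? ≠ some x) :
    IsLCPrefix v (v ++ u) (v ++ z) := by
  refine ⟨List.prefix_append _ _, List.prefix_append _ _, fun q hq hq' => ?_⟩
  by_contra! hlt
  obtain ⟨r, rfl⟩ := List.prefix_of_prefix_length_le (List.prefix_append v u) hq hlt.le
  rw [List.prefix_append_right_inj] at hq hq'
  cases r with
  | nil => simp at hlt
  | cons x r =>
    obtain ⟨_, rfl⟩ := hq
    obtain ⟨_, rfl⟩ := hq'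
    exact h x rfl rfl

lemma isLCSuffix_append {v u z : Word S} (h : ∀ x, u.getLast? = some x → z.getLast? ≠ some x) :
    IsLCSuffix v (u ++ v) (z ++ v) := by
  refine ⟨List.suffix_append _ _, List.suffix_append _ _, fun q hq hq' => ?_⟩
  have := (isLCPrefix_append (v := v.reverse) (u := u.reverse) (z := z.reverse)
    (by simpa using h)).2.2 q.reverse
  simp only [← List.reverse_append, List.reverse_prefix, List.length_reverse] at this
  exact this hq hq'

lemma head?_wordInv_s4 (w : Word S) :
    (wordInv w).head? = w.getLast?.map fun x => (x.1, !x.2) := by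
  simp [wordInv]

lemma getLast?_wordInv_s4 (w : Word S) :
    (wordInv w).getLast? = w.head?.map fun x => (x.1, !x.2) := by
  simp [wordInv]

lemma isRel_run {A : ArtinData S} {s t : S} (hst : s ≠ t) {M : ℕ} (hM : A.m s t = (M : ℕ∞))
    (c : Bool) : IsRel A (run s t c true M) (run s t (!c) true M) := by
  refine ⟨cond c s t, cond (!c) s t, M, ?_, ?_, (altWord_eq_run s t c M).symm, ?_⟩
  · cases c <;> simp [hst, hst.symm]
  · cases c
    · simpa [A.symm] using hM
    · simpa using hM
  · rw [← altWord_eq_run, Bool.not_not]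

lemma BlockSwap.step2Star {A : ArtinData S} {s t : S} (hst : s ≠ t) {M : ℕ}
    (hM : A.m s t = (M : ℕ∞)) {P Q : List (Bool × ℕ)} (h : BlockSwap M P Q)
    (hP : ∀ x ∈ P, 1 ≤ x.2 ∧ x.2 < M) (c : Bool) :
    Step2Star A (ofBlocks s t c P) (ofBlocks s t c Q) := by
  obtain ⟨L₁, L₂, b, k, l, rfl, rfl⟩ := h
  have hk := hP (b, k) (by simp)
  have hl := hP (!b, l) (by simp)
  have h1 : ∀ x ∈ L₁, 1 ≤ x.2 := fun x hx => (hP x (by simp [hx])).1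
  have h2 : ∀ x ∈ L₂, 1 ≤ x.2 := fun x hx => (hP x (by simp [hx])).1
  simp only at hk hl
  obtain ⟨k', rfl⟩ : ∃ k', M = k + k' := ⟨M - k, by omega⟩
  obtain ⟨l', hl'⟩ : ∃ l', k + k' = l + l' := ⟨k + k' - l, by omega⟩
  have hMk : k + k' - k = k' := by omega
  have hMl : k + k' - l = l' := by omega
  have hbodd : l'.bodd = (k.bodd ^^ k'.bodd ^^ l.bodd) := by
    have := congrArg Nat.bodd hl'
    rw [Nat.bodd_add, Nat.bodd_add] at this
    rw [this]
    cases l.bodd <;> simp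
  simp only [hMk, hMl, ofBlocks_append, ofBlocks]
  have hlast := fun y => getLast?_ofBlocks (s := s) (t := t) (c := c) h1 (y := y)
  generalize ofBlocks s t c L₁ = w₁ at hlast ⊢
  generalize endLetter c L₁ = d at hlast ⊢
  have hend : (d ^^ !k'.bodd ^^ !l'.bodd) = (d ^^ !k.bodd ^^ !l.bodd) := by
    rw [hbodd]
    cases d <;> cases k.bodd <;> cases k'.bodd <;> cases l.bodd <;> rfl
  rw [hend]
  have hhead := fun y => head?_ofBlocks (s := s) (t := t) (c := d ^^ !k.bodd ^^ !l.bodd) h2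
    (y := y)
  generalize ofBlocks s t (d ^^ !k.bodd ^^ !l.bodd) L₂ = w₂ at hhead ⊢
  have hrel := isRel_run hst hM
  have hk' : k' = (k' - 1) + 1 := by omega
  have hl'' : l' = (l' - 1) + 1 := by omega
  cases b with
  | false =>
    left
    refine ⟨w₁, w₂, run s t (d ^^ k.bodd) true k, run s t d true k',
      run s t (d ^^ !k.bodd) true l, run s t (d ^^ !k.bodd ^^ l.bodd) true l', ?_,
      run_ne_nil _ _ _ _ hk.1, run_ne_nil _ _ _ _ hl.1, ?_, ?_, ?_, ?_⟩
    · have := hrel (d ^^ k.bodd)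
      rw [run_add] at this
      rw [← run_add, ← hl']
      convert this using 2
      · congr 1
        cases d <;> cases k.bodd <;> rfl
      · cases d <;> cases k.bodd <;> rfl
    · rw [wordInv_run]
      simp
    · rw [wordInv_run, hbodd]
      simp only [List.append_assoc, Bool.not_true, Bool.not_false, Bool.xor_false]
      congr 3
      cases d <;> cases k.bodd <;> cases k'.bodd <;> cases l.bodd <;> rfl
    · refine isLCPrefix_append fun x hx hx' => ?_
      rw [hk', run, List.head?_cons, Option.some.injEq] at hx
      subst hx
      rw [head?_wordInv_s4, Option.map_eq_some_iff] at hx'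
      obtain ⟨y, hy, hy'⟩ := hx'
      rw [hlast y hy] at hy'
      generalize y.2 = a at hy'
      revert hy'
      cases d <;> cases a <;> simp [hst, hst.symm]
    · refine isLCPrefix_append fun x hx hx' => ?_
      rw [hl'', run, List.head?_cons, Option.some.injEq] at hx
      subst hx
      have := hhead _ hx'
      revert this
      cases d <;> cases k.bodd <;> cases l.bodd <;> simp [hst, hst.symm]
  | true =>
    right
    refine ⟨w₁, w₂, run s t d true k, run s t (d ^^ k'.bodd) true k',
      run s t (d ^^ !k.bodd ^^ !l.bodd ^^ true) true l, run s t (d ^^ !k'.bodd) true l', ?_,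
      run_ne_nil _ _ _ _ hk.1, run_ne_nil _ _ _ _ hl.1, ?_, ?_, ?_, ?_⟩
    · have := hrel (d ^^ k'.bodd)
      rw [Nat.add_comm k k', run_add, Nat.add_comm k' k, hl', Nat.add_comm l l', run_add,
        hbodd] at this
      convert this using 3 <;>
        cases d <;> cases k.bodd <;> cases k'.bodd <;> cases l.bodd <;> rfl
    · rw [wordInv_run]
      simp only [List.append_assoc, Bool.not_true, Bool.xor_false]
      congr 3
      cases d <;> cases k.bodd <;> cases l.bodd <;> rfl
    · rw [wordInv_run]
      simp only [List.append_assoc, Bool.not_true, Bool.not_false, Bool.xor_false]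
      congr 2
      cases d <;> cases k'.bodd <;> rfl
    · refine isLCSuffix_append fun x hx hx' => ?_
      rw [hk', getLast?_run_succ, Option.some.injEq] at hx
      subst hx
      have := hlast _ hx'
      rw [Nat.bodd_succ] at this
      revert this
      cases d <;> cases (k' - 1).bodd <;> simp [hst, hst.symm]
    · refine isLCSuffix_append fun x hx hx' => ?_
      rw [hl'', getLast?_run_succ, Option.some.injEq] at hx
      subst hx
      rw [getLast?_wordInv_s4, Option.map_eq_some_iff] at hx'
      obtain ⟨y, hy, hy'⟩ := hx'
      rw [hhead y hy] at hy'
      generalize y.2 = a at hy'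
      have hb : (l' - 1).bodd = !(k.bodd ^^ k'.bodd ^^ l.bodd) := by
        rw [← hbodd, hl'', Nat.bodd_succ]
        simp
      rw [hb] at hy'
      revert hy'
      cases d <;> cases k.bodd <;> cases k'.bodd <;> cases l.bodd <;> cases a <;>
        simp [hst, hst.symm]

/-! ### Evaluation in the group -/

lemma wbar_append (A : ArtinData S) (u v : Word S) : wbar A (u ++ v) = wbar A u * wbar A v := by
  rw [wbar, ← FreeGroup.mul_mk, map_mul]; rfl

lemma wbar_wordInv (A : ArtinData S) (u : Word S) : wbar A (wordInv u) = (wbar A u)⁻¹ := by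
  rw [wbar, wbar, ← map_inv, FreeGroup.inv_mk]
  simp [wordInv, FreeGroup.invRev, List.map_reverse]

lemma IsRel.wbar_eq {A : ArtinData S} {u v : Word S} (h : IsRel A u v) :
    wbar A u = wbar A v := by
  rw [← mul_inv_eq_one, wbar, wbar, ← map_inv, ← map_mul]
  exact PresentedGroup.one_of_mem ⟨u, v, h, rfl⟩

lemma Step2Star.wbar_eq {A : ArtinData S} {w w' : Word S} (h : Step2Star A w w') :
    wbar A w = wbar A w' := by
  rcases h with ⟨w₁, w₂, v, u, v', u', hr, -, -, rfl, rfl, -⟩ |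
    ⟨w₁, w₂, v, u, v', u', hr, -, -, rfl, rfl, -⟩
  · have := hr.wbar_eq
    simp only [wbar_append, wbar_wordInv] at this ⊢
    have h2 : (wbar A v)⁻¹ * wbar A v' = wbar A u * (wbar A u')⁻¹ := by
      rw [inv_mul_eq_iff_eq_mul, ← mul_assoc, this, mul_inv_cancel_right]
    rw [mul_assoc (wbar A w₁), h2]
    simp only [mul_assoc]
  · have := hr.wbar_eq
    simp only [wbar_append, wbar_wordInv] at this ⊢
    have h2 : wbar A v * (wbar A v')⁻¹ = (wbar A u)⁻¹ * wbar A u' := by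
      rw [eq_inv_mul_iff_mul_eq, ← mul_assoc, this, mul_inv_cancel_right]
    rw [mul_assoc (wbar A w₁), h2]
    simp only [mul_assoc]

/-- The action on normal forms of the element represented by a word. -/
noncomputable def wordPerm (s : S) {M : ℕ} (hM : 2 ≤ M) (w : Word S) : Equiv.Perm (NF M) :=
  FreeGroup.lift (fun x : S => genPerm hM (decide (x = s))) (FreeGroup.mk w)

lemma wordPerm_cons_true {s t : S} (hst : s ≠ t) {M : ℕ} (hM : 2 ≤ M) (c : Bool) (w : Word S)
    (x : NF M) : (wordPerm s hM ((cond c s t, true) :: w) x).1 =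
      pushNF M c (wordPerm s hM w x).1 := by
  have : decide (cond c s t = s) = c := by cases c <;> simp [hst.symm]
  simp [wordPerm, this, genPerm]

lemma wordPerm_cons_false {s t : S} (hst : s ≠ t) {M : ℕ} (hM : 2 ≤ M) (c : Bool) (w : Word S)
    (x : NF M) : (wordPerm s hM ((cond c s t, false) :: w) x).1 =
      popNF M c (wordPerm s hM w x).1 := by
  have : decide (cond c s t = s) = c := by cases c <;> simp [hst.symm]
  simp [wordPerm, this, genPerm]

lemma wordPerm_run_true {s t : S} (hst : s ≠ t) {M : ℕ} (hM : 2 ≤ M) (c : Bool) (k : ℕ)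
    (w : Word S) (x : NF M) : (wordPerm s hM (run s t c true k ++ w) x).1 =
      pushAlt M c k (wordPerm s hM w x).1 := by
  induction k generalizing c with
  | zero => rfl
  | succ k ih => rw [run, List.cons_append, wordPerm_cons_true hst, ih, pushAlt]

lemma wordPerm_run_false {s t : S} (hst : s ≠ t) {M : ℕ} (hM : 2 ≤ M) {c c' : Bool} {k : ℕ}
    (hk : k + 1 < M) {r : ℤ} {L : List ℕ}
    {w : Word S} {x : NF M} (h : (wordPerm s hM w x).1 = mkNF r c' L) (hc : c' = (c ^^ !k.bodd)) :
    (wordPerm s hM (run s t c false (k + 1) ++ w) x).1 = (r - 1, !c, (M - (k + 1)) :: L) := by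
  induction k generalizing c with
  | zero =>
    have hc' : c = !c' := by cases c <;> simp_all
    rw [run, run, List.singleton_append, wordPerm_cons_false hst, h, hc', popNF_mkNF]
    simp
  | succ k ih =>
    rw [run, List.cons_append, wordPerm_cons_false hst,
      ih (by omega) (by rw [hc]; cases c <;> simp)]
    have h1 : M - (k + 1) ≠ 1 := by omega
    simp [popNF, h1]
    omega

lemma wordPerm_ofBlocks {s t : S} (hst : s ≠ t) {M : ℕ} (hM : 2 ≤ M) {L : List (Bool × ℕ)}
    (hL : ∀ x ∈ L, 1 ≤ x.2 ∧ x.2 < M) (c : Bool) :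
    (wordPerm s hM (ofBlocks s t c L) ⟨mkNF 0 true [], validNF_mkNF (by simp)⟩).1 =
      mkNF (-((L.map Prod.fst).count false : ℤ)) c (L.map (blockLength M)) := by
  induction L generalizing c with
  | nil => simp [ofBlocks, wordPerm, ← FreeGroup.one_eq_mk]
  | cons y L ih =>
    obtain ⟨b, l⟩ := y
    simp only [List.mem_cons, forall_eq_or_imp] at hL
    obtain ⟨k, rfl⟩ : ∃ k, l = k + 1 := ⟨l - 1, by omega⟩
    cases b with
    | true =>
      rw [ofBlocks, wordPerm_run_true hst, ih hL.2,
        pushAlt_mkNF (by omega) (by cases c <;> simp)]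
      simp [blockLength]
    | false =>
      rw [ofBlocks, wordPerm_run_false hst hM (by omega) (ih hL.2 _) (by cases c <;> simp)]
      simp [blockLength]
      ring

lemma wordPerm_eq_of_wbar_eq {A : ArtinData S} {s t : S} {M : ℕ} (hst : s ≠ t)
    (hdih : ∀ x : S, x = s ∨ x = t) (hM : A.m s t = (M : ℕ∞)) (h2 : 2 ≤ M) {w w' : Word S}
    (h : wbar A w = wbar A w') : wordPerm s h2 w = wordPerm s h2 w' := by
  have hrun : ∀ (c : Bool), wordPerm s h2 (run s t c true M) =
      wordPerm s h2 (run s t (!c) true M) := by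
    intro c
    ext1 x
    apply Subtype.ext
    have := fun c => wordPerm_run_true hst h2 c M [] x
    simp only [List.append_nil] at this
    rw [this, this, pushAlt_delta h2 _ (Subtype.prop _), pushAlt_delta h2 _ (Subtype.prop _)]
  have hrels : ∀ r ∈ rels A,
      FreeGroup.lift (fun x : S => genPerm h2 (decide (x = s))) r = 1 := by
    rintro _ ⟨u, v, ⟨a, b, k, hab, hk, rfl, rfl⟩, rfl⟩
    rw [map_mul, map_inv, mul_inv_eq_one]
    obtain ⟨c, rfl, rfl⟩ : ∃ c : Bool, a = cond c s t ∧ b = cond (!c) s t := by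
      rcases hdih a with rfl | rfl <;> rcases hdih b with rfl | rfl
      · exact absurd rfl hab
      · exact ⟨true, rfl, rfl⟩
      · exact ⟨false, rfl, rfl⟩
      · exact absurd rfl hab
    have hkM : k = M := by
      have : A.m (cond c s t) (cond (!c) s t) = A.m s t := by
        cases c
        · exact A.symm _ _
        · rfl
      rw [this, hM] at hk
      exact_mod_cast hk.symm
    subst hkM
    have := altWord_eq_run s t (!c) k
    rw [Bool.not_not] at this
    rw [altWord_eq_run, this]
    exact hrun c
  have := congrArg (PresentedGroup.toGroup hrels) h
  exact this

/-- Proposition 2.8: in a dihedral Artin–Tits group with `m < ∞`, for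
`w, w' ∈ Ω(Γ₀)`: `w →_{2⋆} w'` iff `w` and `w'` represent the same element. -/
theorem stmt4 {S : Type*} [Finite S] (A : ArtinData S) (s t : S) (M : ℕ)
    (hst : s ≠ t) (hdih : ∀ x : S, x = s ∨ x = t) (hM : A.m s t = (M : ℕ∞))
    (w w' : Word S) (h : Omega M w) (h' : Omega M w') :
    Steps2Star A w w' ↔ wbar A w = wbar A w' := by
  have h2 : 2 ≤ M := by
    have := A.two_le s t hst
    rw [hM] at this
    exact_mod_cast this
  obtain ⟨c, L, hL, rfl⟩ := h.exists_ofBlocks hst hdih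
  obtain ⟨c', L', hL', rfl⟩ := h'.exists_ofBlocks hst hdih
  constructor
  · intro hs
    unfold Steps2Star at hs
    generalize ofBlocks s t c' L' = v at hs
    induction hs with
    | refl => rfl
    | tail _ hstep ih => exact ih.trans hstep.wbar_eq
  · intro heq
    have he := congrArg (fun f => (f ⟨mkNF 0 true [], validNF_mkNF (by simp)⟩).1)
      (wordPerm_eq_of_wbar_eq hst hdih hM h2 heq)
    simp only [wordPerm_ofBlocks hst h2 hL, wordPerm_ofBlocks hst h2 hL'] at he
    have hsw : SwapEquiv M L L' := ⟨congrArg (fun x => x.2.2) he, by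
      simpa [mkNF] using congrArg Prod.fst he⟩
    have hc : ofBlocks s t c' L' = ofBlocks s t c L' := by
      cases L' with
      | nil => rfl
      | cons y L' =>
        cases L with
        | nil => simpa using hsw.1
        | cons x L =>
          simp at he
          rw [he.2.1]
    rw [hc]
    have hreach := hsw.reflTransGen hL hL'
    clear hsw hc he heq h' hL'
    induction hreach with
    | refl => exact .refl
    | tail hP hs ih => exact ih.tail (hs.step2Star hst hM (reflTransGen_blockSwap hP hL).1 c)

end ArtinTits
end
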